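/- There is no Borel probability measure μ on ℝ with μ(ℝ \ 𝕃) = 0 for which there exist constants C > 0 and M > 1 such that |μ̂(ξ)| ≤ C·|ξ|^(−|cos(πξ)|) for all ξ ∈ ℝ with |ξ| ≥ M. -/

import Mathlib

open MeasureTheory Filter Set

/-- The Fourier transform of a measure on `ℝ`: `μ̂(ξ) = ∫ e^(−2πiξx) dμ(x)`. -/
noncomputable def fourierT (μ : Measure ℝ) (ξ : ℝ) : ℂ :=
  ∫ x, Complex.exp (((-2 * Real.pi * ξ * x : ℝ) : ℂ) * Complex.I) ∂μ

open scoped ENNReal ComplexConjugate in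
lemma aux_density (ν : Measure UnitAddCircle) [IsFiniteMeasure ν]
    (h : Memℓp (fun n : ℤ => conj (∫ x, fourier n x ∂ν)) 2) :
    ∃ F : Lp ℂ 2 (@AddCircle.haarAddCircle 1 _), ∀ g : C(UnitAddCircle, ℂ),
      ∫ x, g x ∂ν = inner ℂ F (ContinuousMap.toLp (E := ℂ) 2 AddCircle.haarAddCircle ℂ g) := by
  let a : lp (fun _ : ℤ => ℂ) 2 := ⟨_, h⟩
  let F := (@fourierBasis 1 _).repr.symm a
  refine ⟨F, fun g => ?_⟩
  let L1 : C(UnitAddCircle, ℂ) →L[ℂ] ℂ :=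
    (innerSL ℂ (ContinuousMap.toLp (E := ℂ) 2 ν ℂ 1)).comp (ContinuousMap.toLp (E := ℂ) 2 ν ℂ)
  let L2 : C(UnitAddCircle, ℂ) →L[ℂ] ℂ :=
    (innerSL ℂ F).comp (ContinuousMap.toLp (E := ℂ) 2 AddCircle.haarAddCircle ℂ)
  have h1 : ∀ g, L1 g = ∫ x, g x ∂ν := by
    intro g
    change inner ℂ (ContinuousMap.toLp (E := ℂ) 2 ν ℂ 1) (ContinuousMap.toLp (E := ℂ) 2 ν ℂ g) = _
    rw [ContinuousMap.inner_toLp]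
    simp
  have key : L1 = L2 := by
    refine ContinuousLinearMap.ext_on (s := range (@fourier 1)) ?_ ?_
    · rw [Submodule.dense_iff_topologicalClosure_eq_top]
      exact span_fourier_closure_eq_top
    · rintro _ ⟨n, rfl⟩
      rw [h1]
      change _ = inner ℂ F (fourierLp 2 n)
      rw [← coe_fourierBasis, ← inner_conj_symm, ← HilbertBasis.repr_apply_apply]
      simp [F, a, -fourier_apply]
  rw [← h1, key]
  rfl

open scoped ENNReal in
lemma aux_ac (ν : Measure UnitAddCircle) [IsFiniteMeasure ν]
    (F : Lp ℂ 2 (@AddCircle.haarAddCircle 1 _))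
    (hF : ∀ g : C(UnitAddCircle, ℂ),
      ∫ x, g x ∂ν = inner ℂ F (ContinuousMap.toLp (E := ℂ) 2 AddCircle.haarAddCircle ℂ g))
    (S : Set UnitAddCircle) (hS : MeasurableSet S)
    (h0 : (@AddCircle.haarAddCircle 1 _) S = 0) : ν S = 0 := by
  by_contra hne
  obtain ⟨K, hKS, hK, hpos⟩ := hS.exists_lt_isCompact (pos_iff_ne_zero.2 hne)
  have hK0 : (@AddCircle.haarAddCircle 1 _) K = 0 := measure_mono_null hKS h0
  have hreal : 0 < ν.real K := ENNReal.toReal_pos hpos.ne' (measure_ne_top _ _)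
  -- bound
  have hb : ∀ ε : ℝ, 0 < ε → (ν.real K) ^ 2 ≤ ‖F‖ ^ 2 * ε := by
    intro ε hε
    obtain ⟨U, hKU, hU, hUε⟩ := K.exists_isOpen_lt_of_lt (μ := (@AddCircle.haarAddCircle 1 _))
      (ENNReal.ofReal ε) (by rw [hK0]; simpa using hε)
    obtain ⟨f, hf1, hf0, -, hf⟩ := exists_continuous_one_zero_of_isCompact hK hU.isClosed_compl
      (by rw [Set.disjoint_compl_right_iff_subset]; exact hKU)
    let g : C(UnitAddCircle, ℂ) := ⟨fun x => (f x : ℂ), by fun_prop⟩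
    have e1 : ν.real K ≤ ‖∫ x, g x ∂ν‖ := by
      have : ∫ x, g x ∂ν = ((∫ x, f x ∂ν : ℝ) : ℂ) := integral_ofReal
      rw [this, Complex.norm_real]
      refine le_trans ?_ (le_abs_self _)
      rw [← integral_indicator_one hK.measurableSet]
      refine integral_mono ?_ ?_ ?_
      · exact (integrable_const (1:ℝ)).indicator hK.measurableSet
      · exact f.continuous.integrable_of_hasCompactSupport
          (HasCompactSupport.of_compactSpace f)
      · intro x
        by_cases hx : x ∈ K
        · simp [hx, hf1 hx]
        · simp [hx, (hf x).1]
    set G := ContinuousMap.toLp (E := ℂ) 2 (@AddCircle.haarAddCircle 1 _) ℂ g with hG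
    have e2 : ‖∫ x, g x ∂ν‖ ≤ ‖F‖ * ‖G‖ := by
      rw [hF]; exact norm_inner_le_norm _ _
    have e3 : ‖G‖ ^ 2 ≤ ε := by
      have : ((‖G‖ ^ 2 : ℝ) : ℂ) = ((∫ x, f x ^ 2 ∂(@AddCircle.haarAddCircle 1 _) : ℝ) : ℂ) := by
        have := inner_self_eq_norm_sq_to_K (𝕜 := ℂ) G
        rw [hG, ContinuousMap.inner_toLp, ← hG] at this
        rw [← integral_complex_ofReal]
        push_cast
        rw [show ((‖G‖ : ℂ)) ^ 2 = _ from this.symm]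
        simp [g, sq]
      have h2 : ‖G‖ ^ 2 = ∫ x, f x ^ 2 ∂(@AddCircle.haarAddCircle 1 _) := by exact_mod_cast this
      rw [h2]
      calc _ ≤ ∫ x, U.indicator 1 x ∂(@AddCircle.haarAddCircle 1 _) := by
            refine integral_mono ?_ ?_ ?_
            · exact (f.continuous.pow 2).integrable_of_hasCompactSupport
                (HasCompactSupport.of_compactSpace _)
            · exact (integrable_const (1:ℝ)).indicator hU.measurableSet
            · intro x
              by_cases hx : x ∈ U
              · simp only [hx, indicator_of_mem, Pi.one_apply]
                exact pow_le_one₀ (hf x).1 (hf x).2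
              · have := hf0 (show x ∈ Uᶜ from hx)
                simp [hx, this]
        _ = (@AddCircle.haarAddCircle 1 _).real U := integral_indicator_one hU.measurableSet
        _ ≤ ε := ENNReal.toReal_le_of_le_ofReal hε.le hUε.le
    calc (ν.real K) ^ 2 ≤ (‖F‖ * ‖G‖) ^ 2 := by gcongr; exact e1.trans e2
      _ = ‖F‖ ^ 2 * ‖G‖ ^ 2 := by ring
      _ ≤ _ := by gcongr
  have := hb ((ν.real K) ^ 2 / (2 * (‖F‖ ^ 2 + 1))) (by positivity)
  have hp : 0 < (ν.real K) ^ 2 := by positivity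
  rw [mul_div_assoc', le_div_iff₀ (by positivity)] at this
  nlinarith [sq_nonneg ‖F‖, mul_nonneg hp.le (sq_nonneg ‖F‖)]

lemma aux_liouville (x : ℝ) (n : ℤ) (h : Liouville x) : Liouville (x - n) := by
  rw [← forall_liouvilleWith_iff] at h ⊢
  intro p
  exact (h p).sub_int n

theorem stmt13 :
    ¬ ∃ μ : Measure ℝ, IsProbabilityMeasure μ ∧ μ {x : ℝ | Liouville x}ᶜ = 0 ∧
      ∃ C > (0 : ℝ), ∃ M > (1 : ℝ),
        ∀ ξ : ℝ, M ≤ |ξ| →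
          ‖fourierT μ ξ‖ ≤ C * |ξ| ^ (-|Real.cos (Real.pi * ξ)|) := by
  rintro ⟨μ, hμ, hL, C, hC, M, hM, hdec⟩
  have hmk : Measurable ((↑) : ℝ → UnitAddCircle) := AddCircle.measurable_mk'
  let ν : Measure UnitAddCircle := μ.map (↑)
  have : IsProbabilityMeasure ν := Measure.isProbabilityMeasure_map hmk.aemeasurable
  have hcoef : ∀ n : ℤ, ∫ x, fourier n x ∂ν = fourierT μ (-n : ℝ) := by
    intro n
    rw [integral_map hmk.aemeasurable (fourier n).continuous.aestronglyMeasurable, fourierT]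
    congr 1
    ext x
    rw [fourier_coe_apply]
    congr 1
    push_cast
    ring
  have hmem : Memℓp (fun n : ℤ => (starRingEnd ℂ) (∫ x, fourier n x ∂ν)) 2 := by
    apply memℓp_gen
    have hs : Summable (fun n : ℤ => C ^ 2 * (1 / (n : ℝ) ^ 2)) :=
      (Real.summable_one_div_int_pow.2 (by norm_num)).mul_left _
    refine Summable.of_norm_bounded_eventually hs ?_
    have hfin : {n : ℤ | |(n : ℝ)| < M}.Finite := by
      refine (Set.finite_Icc (-⌈M⌉) ⌈M⌉).subset ?_
      intro n hn
      have hn' := abs_lt.1 (show |(n : ℝ)| < M from hn)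
      have := Int.le_ceil M
      constructor
      · have : (-(⌈M⌉ : ℤ) : ℝ) ≤ n := by linarith
        exact_mod_cast this
      · have : (n : ℝ) ≤ ⌈M⌉ := by linarith
        exact_mod_cast this
    filter_upwards [hfin.compl_mem_cofinite] with n hn
    have hn : M ≤ |(n : ℝ)| := not_lt.1 hn
    have hd := hdec (-n : ℝ) (by simpa using hn)
    have hcos : |Real.cos (Real.pi * (-n : ℝ))| = 1 := by
      rw [mul_neg, Real.cos_neg, mul_comm, Real.abs_cos_int_mul_pi]
    rw [hcos, Real.rpow_neg_one, abs_neg] at hd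
    rw [hcoef]
    simp only [RCLike.norm_conj, ENNReal.toReal_ofNat, Real.rpow_ofNat, norm_pow, norm_norm]
    calc _ ≤ (C * |(n : ℝ)|⁻¹) ^ 2 := by gcongr
      _ = _ := by rw [mul_pow, inv_pow, sq_abs, one_div]
  obtain ⟨F, hF⟩ := aux_density ν hmem
  let T : Set UnitAddCircle := {x | Liouville ((AddCircle.equivIoc (1:ℝ) 0 x : ℝ))}
  have hT : MeasurableSet T := by
    have h1 : MeasurableSet {x : ℝ | Liouville x} := IsGδ.setOfPred_liouville.measurableSet
    exact (measurable_subtype_coe.comp (AddCircle.measurableEquivIoc 1 0).measurable) h1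
  have hpre : ∀ y : ℝ, (y : UnitAddCircle) ∈ T ↔ Liouville y := by
    intro y
    have : (AddCircle.equivIoc (1:ℝ) 0 (y : UnitAddCircle) : ℝ) = y - (toIocDiv one_pos 0 y : ℤ) := by
      change toIocMod _ 0 y = _
      rw [toIocMod]; simp
    change Liouville _ ↔ _
    rw [this]
    refine ⟨fun h => ?_, aux_liouville _ _⟩
    have := aux_liouville _ (-(toIocDiv one_pos 0 y : ℤ)) h
    simpa using this
  have hT0 : (@AddCircle.haarAddCircle 1 _) T = 0 := by
    have hv : (volume : Measure UnitAddCircle) T = 0 := by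
      rw [← (UnitAddCircle.measurePreserving_mk 0).measure_preimage hT.nullMeasurableSet]
      refine measure_mono_null (fun y hy => (hpre y).1 hy) ?_
      exact Measure.restrict_le_self.absolutelyContinuous volume_setOfPred_liouville
    rw [AddCircle.volume_eq_smul_haarAddCircle] at hv
    simpa using hv
  have hν := aux_ac ν F hF T hT hT0
  rw [Measure.map_apply hmk hT] at hν
  have huniv : μ univ = 0 := by
    refine measure_mono_null (t := {x : ℝ | Liouville x}ᶜ ∪ (↑) ⁻¹' T) ?_
      (measure_union_null hL hν)
    intro y _
    by_cases hy : Liouville y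
    · exact Or.inr ((hpre y).2 hy)
    · exact Or.inl hy
  simp at huniv
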